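/- arXiv:1610.03044 — 2 statements merged into one kernel-verified Lean document; each statement's English description precedes it below -/
import Mathlib

section
/- Let α ∈ ℝ and let y be a minimal solution of the second Painlevé equation y''(s) = s·y(s) + 2·y(s)³ + α. Then the second variation of the energy at y is nonnegative: ∫_ℝ [ φ'(s)² + (6·y(s)² + s)·φ(s)² ] ds ≥ 0 for every C¹ compactly supported φ : ℝ → ℝ. Consequently, if a solution of the second Painlevé equation is bounded on some interval (−∞, m], then it is not minimal. -/
open MeasureTheory Filter Topology Set


/-- The Painlevé II energy of `u` over a set `I`. -/
noncomputable def EPII (α : ℝ) (u : ℝ → ℝ) (I : Set ℝ) : ℝ :=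
  ∫ s in I, ((1:ℝ)/2 * (deriv u s) ^ 2 + 1/2 * s * (u s) ^ 2 + 1/2 * (u s) ^ 4 + α * u s)

/-- A (classical) solution of the second Painlevé equation `y'' = s y + 2 y³ + α`. -/
def PainleveSol (α : ℝ) (y : ℝ → ℝ) : Prop :=
  ContDiff ℝ 2 y ∧ ∀ s : ℝ, deriv (deriv y) s = s * y s + 2 * (y s) ^ 3 + α

/-- A minimal solution of the second Painlevé equation: it minimizes `E_PII` with respect to
smooth compactly supported perturbations. -/
def MinimalSol (α : ℝ) (y : ℝ → ℝ) : Prop :=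
  PainleveSol α y ∧ ∀ φ : ℝ → ℝ, ContDiff ℝ (⊤ : ℕ∞) φ → HasCompactSupport φ →
    EPII α y (tsupport φ) ≤ EPII α (fun s => y s + φ s) (tsupport φ)

/-- The symmetric second difference of the energy in a smooth compactly supported direction. -/
lemma EPII_add_smul_add_EPII_sub_smul (α : ℝ) {y φ : ℝ → ℝ} (hy : ContDiff ℝ 1 y)
    (hφ : ContDiff ℝ 1 φ) (hc : HasCompactSupport φ) (t : ℝ) :
    EPII α (fun s => y s + t * φ s) (tsupport φ) + EPII α (fun s => y s + -t * φ s) (tsupport φ)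
      = 2 * EPII α y (tsupport φ)
        + (t ^ 2 * (∫ s : ℝ, ((deriv φ s) ^ 2 + (6 * (y s) ^ 2 + s) * (φ s) ^ 2))
        + t ^ 4 * ∫ s in tsupport φ, (φ s) ^ 4) := by
  have hy0 := hy.continuous
  have hφ0 := hφ.continuous
  have hy1 : Continuous (deriv y) := hy.continuous_deriv le_rfl
  have hφ1 : Continuous (deriv φ) := hφ.continuous_deriv le_rfl
  have hK : IsCompact (tsupport φ) := hc
  have hd (r : ℝ) : deriv (fun s => y s + r * φ s) = fun s => deriv y s + r * deriv φ s := by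
    funext s
    have h1 := (hy.differentiable one_ne_zero s).hasDerivAt
    have h2 := ((hφ.differentiable one_ne_zero s).hasDerivAt).const_mul r
    exact (h1.add h2).deriv
  have hQ : ∫ s : ℝ, ((deriv φ s) ^ 2 + (6 * (y s) ^ 2 + s) * (φ s) ^ 2)
      = ∫ s in tsupport φ, ((deriv φ s) ^ 2 + (6 * (y s) ^ 2 + s) * (φ s) ^ 2) := by
    refine (setIntegral_eq_integral_of_forall_compl_eq_zero fun s hs => ?_).symm
    have h1 : φ s = 0 := image_eq_zero_of_notMem_tsupport hs
    have h2 : deriv φ s = 0 := by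
      by_contra h
      exact hs (support_deriv_subset h)
    simp [h1, h2]
  have hI {f : ℝ → ℝ} (hf : Continuous f) : IntegrableOn f (tsupport φ) :=
    hf.continuousOn.integrableOn_compact hK
  rw [hQ]
  unfold EPII
  simp only [hd]
  rw [← integral_const_mul, ← integral_const_mul, ← integral_const_mul, ← integral_add,
    ← integral_add, ← integral_add]
  · congr 1
    funext s
    ring
  all_goals exact hI (by fun_prop)

lemma MinimalSol.secondVariation_nonneg_of_smooth {α : ℝ} {y φ : ℝ → ℝ} (hy : MinimalSol α y)
    (hφ : ContDiff ℝ (⊤ : ℕ∞) φ) (hc : HasCompactSupport φ) :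
    0 ≤ ∫ s : ℝ, ((deriv φ s) ^ 2 + (6 * (y s) ^ 2 + s) * (φ s) ^ 2) := by
  have hmin (t : ℝ) (ht : t ≠ 0) :
      EPII α y (tsupport φ) ≤ EPII α (fun s => y s + t * φ s) (tsupport φ) := by
    have hs : tsupport (fun s => t * φ s) = tsupport φ := by
      unfold tsupport
      congr 1
      ext s
      simp [ht]
    have h := hy.2 (fun s => t * φ s) (contDiff_const.mul hφ) hc.mul_left
    rwa [hs] at h
  have key (t : ℝ) (ht : 0 < t) :=
    EPII_add_smul_add_EPII_sub_smul α (hy.1.1.of_le (by norm_num))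
      (hφ.of_le (by exact_mod_cast le_top)) hc t
  set Q := ∫ s : ℝ, ((deriv φ s) ^ 2 + (6 * (y s) ^ 2 + s) * (φ s) ^ 2)
  set C := ∫ s in tsupport φ, (φ s) ^ 4
  have hpos (t : ℝ) (ht : 0 < t) : 0 ≤ Q + t ^ 2 * C := by
    have h1 := hmin t ht.ne'
    have h2 := hmin (-t) (neg_ne_zero.2 ht.ne')
    have h3 := key t ht
    have h4 : 0 ≤ t ^ 2 * (Q + t ^ 2 * C) := by linarith
    exact nonneg_of_mul_nonneg_right h4 (by positivity)
  have hlim : Tendsto (fun t : ℝ => Q + t ^ 2 * C) (𝓝[>] 0) (𝓝 Q) := by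
    have : Continuous fun t : ℝ => Q + t ^ 2 * C := by fun_prop
    simpa using (this.tendsto 0).mono_left nhdsWithin_le_nhds
  exact ge_of_tendsto hlim (eventually_mem_nhdsWithin.mono fun t ht => hpos t ht)

open scoped Convolution in
/-- Mollifying at scale at most one preserves boundedness and enlarges the support by at most
one. -/
lemma ContDiffBump.normed_convolution_bounds (b : ContDiffBump (0 : ℝ)) (hb : b.rOut ≤ 1)
    {g : ℝ → ℝ} (hg : Continuous g) {r C : ℝ} (hsupp : ∀ s, r < |s| → g s = 0)
    (hC : ∀ s, |g s| ≤ C) (s : ℝ) :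
    (s ∉ Icc (-(r + 1)) (r + 1) →
      (b.normed volume ⋆[ContinuousLinearMap.lsmul ℝ ℝ, volume] g) s = 0) ∧
    |(b.normed volume ⋆[ContinuousLinearMap.lsmul ℝ ℝ, volume] g) s| ≤ 3 * C := by
  constructor
  · intro hs
    have hs' : r + 1 < |s| := by
      by_contra! h
      exact hs (abs_le.1 h)
    have h0 : g s = 0 := hsupp s (by linarith)
    rw [b.normed_convolution_eq_right fun x hx => ?_, h0]
    rw [h0]
    refine hsupp x ?_
    have hx1 : |x - s| < b.rOut := by simpa [Real.dist_eq] using hx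
    have := abs_sub_abs_le_abs_sub s x
    rw [abs_sub_comm] at this
    linarith
  · have h := b.dist_normed_convolution_le (μ := volume) (x₀ := s) (ε := 2 * C)
      hg.aestronglyMeasurable fun x _ => ?_
    · rw [Real.dist_eq] at h
      have h2 := abs_sub_abs_le_abs_sub
        ((b.normed volume ⋆[ContinuousLinearMap.lsmul ℝ ℝ, volume] g) s) (g s)
      linarith [hC s]
    · rw [Real.dist_eq]
      linarith [abs_sub (g x) (g s), hC x, hC s]

open scoped Convolution in
/-- A `C¹` function with compact support is a limit of smooth ones, together with its derivative,
boundedly and with supports in a fixed compact set. -/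
lemma exists_smooth_approx_of_contDiff_one {φ : ℝ → ℝ} (hφ : ContDiff ℝ 1 φ)
    (hc : HasCompactSupport φ) :
    ∃ (ψ : ℕ → ℝ → ℝ) (R B : ℝ), (∀ n, ContDiff ℝ (⊤ : ℕ∞) (ψ n)) ∧
      (∀ n s, s ∉ Icc (-R) R → ψ n s = 0 ∧ deriv (ψ n) s = 0) ∧
      (∀ n s, |ψ n s| ≤ B ∧ |deriv (ψ n) s| ≤ B) ∧
      ∀ s, Tendsto (fun n => ψ n s) atTop (𝓝 (φ s)) ∧
        Tendsto (fun n => deriv (ψ n) s) atTop (𝓝 (deriv φ s)) := by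
  have hφ1 : Continuous (deriv φ) := hφ.continuous_deriv le_rfl
  obtain ⟨C₀, hC₀⟩ := hc.exists_bound_of_continuous hφ.continuous
  obtain ⟨C₁, hC₁⟩ := hc.deriv.exists_bound_of_continuous hφ1
  obtain ⟨r, hr⟩ := hc.isBounded.exists_norm_le
  have hs0 (s : ℝ) (hs : r < |s|) : φ s = 0 :=
    image_eq_zero_of_notMem_tsupport fun h => (hr s h).not_gt hs
  have hs1 (s : ℝ) (hs : r < |s|) : deriv φ s = 0 := by
    by_contra h
    exact (hr s (support_deriv_subset h)).not_gt hs
  let b (n : ℕ) : ContDiffBump (0 : ℝ) :=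
    ⟨1 / ((n : ℝ) + 1) / 2, 1 / ((n : ℝ) + 1), by positivity, half_lt_self (by positivity)⟩
  have hb (n : ℕ) : (b n).rOut ≤ 1 := by
    change 1 / ((n : ℝ) + 1) ≤ 1
    rw [div_le_one (by positivity)]
    linarith [n.cast_nonneg (α := ℝ)]
  have hb0 : Tendsto (fun n => (b n).rOut) atTop (𝓝 0) := tendsto_one_div_add_atTop_nhds_zero_nat
  have hloc (n : ℕ) : LocallyIntegrable ((b n).normed volume) :=
    (b n).continuous_normed.locallyIntegrable
  have hd (n : ℕ) : deriv ((b n).normed volume ⋆[ContinuousLinearMap.lsmul ℝ ℝ, volume] φ)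
      = (b n).normed volume ⋆[ContinuousLinearMap.lsmul ℝ ℝ, volume] (deriv φ) := by
    funext s
    exact (hc.hasDerivAt_convolution_right _ (hloc n) hφ s).deriv
  have hbd0 (n : ℕ) := (b n).normed_convolution_bounds (hb n) hφ.continuous hs0 hC₀
  have hbd1 (n : ℕ) := (b n).normed_convolution_bounds (hb n) hφ1 hs1 hC₁
  refine ⟨fun n => (b n).normed volume ⋆[ContinuousLinearMap.lsmul ℝ ℝ, volume] φ, r + 1,
    max (3 * C₀) (3 * C₁), fun n => ?_, fun n s hs => ?_, fun n s => ?_, fun s => ?_⟩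
  · exact (b n).hasCompactSupport_normed.contDiff_convolution_left _ (b n).contDiff_normed
      hφ.continuous.locallyIntegrable
  · rw [hd]
    exact ⟨(hbd0 n s).1 hs, (hbd1 n s).1 hs⟩
  · rw [hd]
    exact ⟨(hbd0 n s).2.trans (le_max_left _ _), (hbd1 n s).2.trans (le_max_right _ _)⟩
  · simp only [hd]
    exact ⟨ContDiffBump.convolution_tendsto_right_of_continuous hb0 hφ.continuous s,
      ContDiffBump.convolution_tendsto_right_of_continuous hb0 hφ1 s⟩

lemma MinimalSol.secondVariation_nonneg {α : ℝ} {y φ : ℝ → ℝ} (hy : MinimalSol α y)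
    (hφ : ContDiff ℝ 1 φ) (hc : HasCompactSupport φ) :
    0 ≤ ∫ s : ℝ, ((deriv φ s) ^ 2 + (6 * (y s) ^ 2 + s) * (φ s) ^ 2) := by
  obtain ⟨ψ, R, B, hsm, hsupp, hB, hlim⟩ := exists_smooth_approx_of_contDiff_one hφ hc
  have hy0 : Continuous y := hy.1.1.continuous
  have hlimint : Tendsto
      (fun n => ∫ s : ℝ, ((deriv (ψ n) s) ^ 2 + (6 * (y s) ^ 2 + s) * (ψ n s) ^ 2)) atTop
      (𝓝 (∫ s : ℝ, ((deriv φ s) ^ 2 + (6 * (y s) ^ 2 + s) * (φ s) ^ 2))) := by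
    refine tendsto_integral_of_dominated_convergence
      ((Icc (-R) R).indicator fun s => B ^ 2 + (6 * (y s) ^ 2 + |s|) * B ^ 2) ?_ ?_ ?_ ?_
    · intro n
      have h0 := (hsm n).continuous
      have h1 : Continuous (deriv (ψ n)) := (hsm n).continuous_deriv (by exact_mod_cast le_top)
      exact Continuous.aestronglyMeasurable (by fun_prop)
    · rw [integrable_indicator_iff measurableSet_Icc]
      exact Continuous.integrableOn_Icc (by fun_prop)
    · refine fun n => Eventually.of_forall fun s => ?_
      by_cases hs : s ∈ Icc (-R) R
      · rw [indicator_of_mem hs, Real.norm_eq_abs]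
        have h0 : (ψ n s) ^ 2 ≤ B ^ 2 := sq_le_sq.2 ((hB n s).1.trans (le_abs_self B))
        have h1 : (deriv (ψ n) s) ^ 2 ≤ B ^ 2 := sq_le_sq.2 ((hB n s).2.trans (le_abs_self B))
        refine (abs_add_le _ _).trans (add_le_add (by rwa [abs_of_nonneg (sq_nonneg _)]) ?_)
        rw [abs_mul, abs_of_nonneg (sq_nonneg (ψ n s))]
        refine mul_le_mul ((abs_add_le _ _).trans ?_) h0 (sq_nonneg _) (by positivity)
        rw [abs_of_nonneg (by positivity : 0 ≤ 6 * (y s) ^ 2)]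
      · rw [indicator_of_notMem hs, (hsupp n s hs).1, (hsupp n s hs).2]
        simp
    · refine Eventually.of_forall fun s => ?_
      exact ((hlim s).2.pow 2).add (((hlim s).1.pow 2).const_mul _)
  refine ge_of_tendsto' hlimint fun n => hy.secondVariation_nonneg_of_smooth (hsm n) ?_
  exact HasCompactSupport.intro isCompact_Icc fun s hs => (hsupp n s hs).1

/-- Below a bounded solution the second variation is negative in suitable directions. -/
lemma exists_secondVariation_neg {z : ℝ → ℝ} (hz : Continuous z) {m M : ℝ}
    (hM : ∀ s ≤ m, |z s| ≤ M) :
    ∃ φ : ℝ → ℝ, ContDiff ℝ 1 φ ∧ HasCompactSupport φ ∧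
      ∫ s : ℝ, ((deriv φ s) ^ 2 + (6 * (z s) ^ 2 + s) * (φ s) ^ 2) < 0 := by
  obtain ⟨b, hbout⟩ : ∃ b : ContDiffBump (0 : ℝ), b.rOut = 2 :=
    ⟨⟨1, 2, one_pos, one_lt_two⟩, rfl⟩
  have hb : ContDiff ℝ 1 b := b.contDiff
  have hb0 : Continuous b := hb.continuous
  have hb1 : Continuous (deriv b) := hb.continuous_deriv le_rfl
  have hbc : HasCompactSupport b := b.hasCompactSupport
  have hsq : HasCompactSupport fun s => (b s) ^ 2 :=
    hbc.comp_left (g := fun x : ℝ => x ^ 2) (by simp)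
  have hdsq : HasCompactSupport fun s => (deriv b s) ^ 2 :=
    hbc.deriv.comp_left (g := fun x : ℝ => x ^ 2) (by simp)
  have hi0 : Integrable fun s => (b s) ^ 2 := (hb0.pow 2).integrable_of_hasCompactSupport hsq
  have hi1 : Integrable fun s => (deriv b s) ^ 2 :=
    (hb1.pow 2).integrable_of_hasCompactSupport hdsq
  obtain ⟨A, hA⟩ : ∃ A, A = ∫ s, (deriv b s) ^ 2 := ⟨_, rfl⟩
  obtain ⟨D, hD⟩ : ∃ D, D = ∫ s, (b s) ^ 2 := ⟨_, rfl⟩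
  have hDpos : 0 < D := by
    rw [hD]
    have h1 : b 0 = 1 := b.one_of_mem_closedBall (by simpa using b.rIn_pos.le)
    have h2 : (b 0) ^ 2 ≠ 0 := by simp [h1]
    have h3 : 0 ≤ fun s => (b s) ^ 2 := fun s => sq_nonneg (b s)
    exact (hb0.pow 2).integral_pos_of_hasCompactSupport_nonneg_nonzero hsq h3 h2
  obtain ⟨c, hcm, hcb⟩ : ∃ c ≤ m - 2, c ≤ -(6 * M ^ 2 + 2) - (A + 1) / D :=
    ⟨_, min_le_left _ _, min_le_right _ _⟩
  have hcA : A + (6 * M ^ 2 + 2 + c) * D < 0 := by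
    have h : 6 * M ^ 2 + 2 + c ≤ -((A + 1) / D) := by linarith
    have h2 := mul_le_mul_of_nonneg_right h hDpos.le
    rw [neg_mul, div_mul_cancel₀ _ hDpos.ne'] at h2
    linarith
  have hbs : ContDiff ℝ 1 fun s => b (s - c) := hb.comp (contDiff_id.sub contDiff_const)
  have hbsc : HasCompactSupport fun s => b (s - c) :=
    hbc.comp_homeomorph (Homeomorph.subRight c)
  refine ⟨fun s => b (s - c), hbs, hbsc, ?_⟩
  have hd : deriv (fun s => b (s - c)) = fun s => deriv b (s - c) := by
    funext s
    exact deriv_comp_sub_const (f := b) c s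
  rw [hd, ← integral_add_right_eq_self _ c]
  simp only [add_sub_cancel_right]
  refine lt_of_le_of_lt ?_ hcA
  rw [hA, hD, ← integral_const_mul, ← integral_add hi1 (hi0.const_mul _)]
  refine integral_mono ?_ (hi1.add (hi0.const_mul _)) fun s => ?_
  · refine hi1.add (Continuous.integrable_of_hasCompactSupport (by fun_prop) ?_)
    exact hsq.mul_left
  · refine add_le_add le_rfl ?_
    by_cases hs : 2 ≤ |s|
    · have : b s = 0 := b.zero_of_le_dist (by simpa [hbout] using hs)
      simp [this]
    · refine mul_le_mul_of_nonneg_right ?_ (sq_nonneg _)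
      have h2 := abs_lt.1 (not_le.1 hs)
      have hzM := hM (s + c) (by linarith)
      have : (z (s + c)) ^ 2 ≤ M ^ 2 := sq_le_sq.2 (hzM.trans (le_abs_self M))
      linarith

/-- The second variation of `E_PII` at a minimal solution is nonnegative; consequently a
solution of Painlevé II bounded on some `(-∞, m]` is not minimal. -/
theorem stmt18 (α : ℝ) (y : ℝ → ℝ) (hy : MinimalSol α y) :
    (∀ φ : ℝ → ℝ, ContDiff ℝ 1 φ → HasCompactSupport φ →
      0 ≤ ∫ s : ℝ, ((deriv φ s) ^ 2 + (6 * (y s) ^ 2 + s) * (φ s) ^ 2)) ∧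
    (∀ z : ℝ → ℝ, PainleveSol α z →
      (∃ m M : ℝ, ∀ s : ℝ, s ≤ m → |z s| ≤ M) → ¬ MinimalSol α z) := by
  refine ⟨fun φ hφ hc => hy.secondVariation_nonneg hφ hc, ?_⟩
  rintro z hz ⟨m, M, hM⟩ hmin
  obtain ⟨φ, hφ, hc, hneg⟩ := exists_secondVariation_neg hz.1.continuous hM
  exact (hmin.secondVariation_nonneg hφ hc).not_gt hneg
end

section
/- Let α < 0 and let y be a solution of the second Painlevé equation y''(s) = s·y(s) + 2·y(s)³ + α that is bounded on a neighborhood of +∞ and satisfies y(s) ≥ 0 for all s ∈ ℝ. Then y(s) > 0 for all s ∈ ℝ, y'(s) < 0 for all s ∈ ℝ, and y(s) − √(|s|/2) → 0 as s → −∞. -/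
open MeasureTheory Filter Topology Set


/-- A function with nonnegative derivative on `[a, b]` satisfies `f a ≤ f b`. -/
lemma le_of_hasDerivAt_nonneg {f g : ℝ → ℝ} {a b : ℝ} (hab : a ≤ b)
    (hf : ∀ t ∈ Icc a b, HasDerivAt f (g t) t) (hg : ∀ t ∈ Icc a b, 0 ≤ g t) : f a ≤ f b := by
  have hmono : MonotoneOn f (Icc a b) := by
    refine monotoneOn_of_deriv_nonneg (convex_Icc a b)
      (fun t ht => (hf t ht).continuousAt.continuousWithinAt)
      (fun t ht => (hf t (interior_subset ht)).differentiableAt.differentiableWithinAt)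
      (fun t ht => ?_)
    rw [(hf t (interior_subset ht)).deriv]
    exact hg t (interior_subset ht)
  exact hmono (left_mem_Icc.2 hab) (right_mem_Icc.2 hab) hab

/-- If `f' = ρ G` with `ρ ≥ 0`, where `G` is nondecreasing as long as `f > ε`, and initially
`f > ε` and `G ≥ 0`, then `f > ε` persists to the right. -/
lemma lt_of_weighted_convex_right {f ρ G K : ℝ → ℝ} {ε a b : ℝ}
    (hf : ∀ t ∈ Icc a b, HasDerivAt f (ρ t * G t) t)
    (hG : ∀ t ∈ Icc a b, HasDerivAt G (K t) t) (hρ : ∀ t ∈ Icc a b, 0 ≤ ρ t)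
    (hK : ∀ t ∈ Icc a b, ε < f t → 0 ≤ K t) (hfa : ε < f a) (hGa : 0 ≤ G a) :
    ∀ t ∈ Icc a b, ε < f t := by
  by_contra! hne
  have hcont : ContinuousOn f (Icc a b) := fun t ht => (hf t ht).continuousAt.continuousWithinAt
  set S := {t | t ∈ Icc a b ∧ f t ≤ ε}
  have hS : IsClosed S := hcont.preimage_isClosed_of_isClosed isClosed_Icc isClosed_Iic
  have hbelow : BddBelow S := ⟨a, fun t ht => ht.1.1⟩
  have hτ : sInf S ∈ S := hS.csInf_mem hne hbelow
  set τ := sInf S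
  have hgt : ∀ t ∈ Icc a b, t < τ → ε < f t := fun t ht htτ => by
    by_contra! h
    exact absurd (csInf_le hbelow (show t ∈ S from ⟨ht, h⟩)) (not_le.2 htτ)
  have hmono : MonotoneOn G (Icc a τ) := by
    have hsub : Icc a τ ⊆ Icc a b := Icc_subset_Icc_right hτ.1.2
    refine monotoneOn_of_deriv_nonneg (convex_Icc a τ)
      (fun t ht => (hG t (hsub ht)).continuousAt.continuousWithinAt)
      (fun t ht => (hG t (hsub (interior_subset ht))).differentiableAt.differentiableWithinAt)
      (fun t ht => ?_)
    rw [(hG t (hsub (interior_subset ht))).deriv]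
    rw [interior_Icc] at ht
    exact hK t (hsub (Ioo_subset_Icc_self ht)) (hgt t (hsub (Ioo_subset_Icc_self ht)) ht.2)
  have hle : f a ≤ f τ := le_of_hasDerivAt_nonneg hτ.1.1
    (fun t ht => hf t ⟨ht.1, ht.2.trans hτ.1.2⟩)
    (fun t ht => mul_nonneg (hρ t ⟨ht.1, ht.2.trans hτ.1.2⟩)
      (hGa.trans (hmono (left_mem_Icc.2 hτ.1.1) ht ht.1)))
  exact absurd (hle.trans hτ.2) (not_le.2 hfa)

lemma HasDerivAt.comp_neg_id {f : ℝ → ℝ} {f' t : ℝ} (hf : HasDerivAt f f' (-t)) :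
    HasDerivAt (fun x => f (-x)) (-f') t := by
  exact (HasDerivAt.comp t hf (hasDerivAt_neg t)).congr_deriv (by simp)

/-- The mirror image of `lt_of_weighted_convex_right`. -/
lemma lt_of_weighted_convex_left {f ρ G K : ℝ → ℝ} {ε a b : ℝ}
    (hf : ∀ t ∈ Icc a b, HasDerivAt f (ρ t * G t) t)
    (hG : ∀ t ∈ Icc a b, HasDerivAt G (K t) t) (hρ : ∀ t ∈ Icc a b, 0 ≤ ρ t)
    (hK : ∀ t ∈ Icc a b, ε < f t → 0 ≤ K t) (hfb : ε < f b) (hGb : G b ≤ 0) :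
    ∀ t ∈ Icc a b, ε < f t := by
  have hneg : ∀ t ∈ Icc (-b) (-a), -t ∈ Icc a b := fun t ht =>
    ⟨by linarith [ht.2], by linarith [ht.1]⟩
  have key := lt_of_weighted_convex_right (f := fun t => f (-t)) (ρ := fun t => ρ (-t))
    (G := fun t => -G (-t)) (K := fun t => K (-t)) (ε := ε) (a := -b) (b := -a)
    (fun t ht => by simpa using (hf (-t) (hneg t ht)).comp_neg_id)
    (fun t ht => by simpa using (hG (-t) (hneg t ht)).comp_neg_id.fun_neg)
    (fun t ht => hρ _ (hneg t ht)) (fun t ht => hK _ (hneg t ht))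
    (by simpa using hfb) (by simpa using hGb)
  intro t ht
  simpa using key (-t) ⟨by linarith [ht.2], by linarith [ht.1]⟩

/-- Quadratic growth to the right of a function with `f'' ≥ c` and `f' a ≥ 0`. -/
lemma add_sq_le_right {f g h : ℝ → ℝ} {a b c : ℝ} (hab : a ≤ b)
    (hf : ∀ t ∈ Icc a b, HasDerivAt f (g t) t) (hg : ∀ t ∈ Icc a b, HasDerivAt g (h t) t)
    (hh : ∀ t ∈ Icc a b, c ≤ h t) (hga : 0 ≤ g a) : f a + c / 2 * (b - a) ^ 2 ≤ f b := by
  have hgt : ∀ t ∈ Icc a b, c * (t - a) ≤ g t := fun t ht => by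
    have := le_of_hasDerivAt_nonneg (f := fun x => g x - c * (x - a)) (g := fun x => h x - c) ht.1
      (fun x hx => by
        simpa using (hg x ⟨hx.1, hx.2.trans ht.2⟩).fun_sub
          (((hasDerivAt_id' x).sub_const a).const_mul c))
      (fun x hx => sub_nonneg.2 (hh x ⟨hx.1, hx.2.trans ht.2⟩))
    simp only [sub_self, mul_zero] at this
    linarith
  have := le_of_hasDerivAt_nonneg (f := fun x => f x - c / 2 * (x - a) ^ 2)
    (g := fun x => g x - c * (x - a)) hab
    (fun x hx => ((hf x hx).fun_sub
      ((((hasDerivAt_id' x).sub_const a).fun_pow 2).const_mul (c / 2))).congr_deriv (by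
        norm_num; ring))
    (fun x hx => sub_nonneg.2 (hgt x hx))
  simp only [sub_self] at this
  linarith

/-- The mirror image of `add_sq_le_right`. -/
lemma add_sq_le_left {f g h : ℝ → ℝ} {a b c : ℝ} (hab : a ≤ b)
    (hf : ∀ t ∈ Icc a b, HasDerivAt f (g t) t) (hg : ∀ t ∈ Icc a b, HasDerivAt g (h t) t)
    (hh : ∀ t ∈ Icc a b, c ≤ h t) (hgb : g b ≤ 0) : f b + c / 2 * (b - a) ^ 2 ≤ f a := by
  have hneg : ∀ t ∈ Icc (-b) (-a), -t ∈ Icc a b := fun t ht =>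
    ⟨by linarith [ht.2], by linarith [ht.1]⟩
  have key := add_sq_le_right (f := fun t => f (-t)) (g := fun t => -g (-t))
    (h := fun t => h (-t)) (c := c) (neg_le_neg hab)
    (fun t ht => (hf (-t) (hneg t ht)).comp_neg_id)
    (fun t ht => by simpa using (hg (-t) (hneg t ht)).comp_neg_id.fun_neg)
    (fun t ht => hh _ (hneg t ht)) (by simpa using hgb)
  simp only [neg_neg] at key
  linarith [show (-a - -b) ^ 2 = (b - a) ^ 2 by ring]

/-- If `f'' ≥ c` wherever `f > ε`, then `f > ε` far to the right forces `f` to be nondecreasing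
there, to remain above `ε` and to grow quadratically. -/
lemma quadratic_growth_of_lt {f g h : ℝ → ℝ} {ε c T t₀ : ℝ} (hc : 0 ≤ c)
    (hf : ∀ t, T ≤ t → HasDerivAt f (g t) t) (hg : ∀ t, T ≤ t → HasDerivAt g (h t) t)
    (hh : ∀ t, T ≤ t → ε < f t → c ≤ h t) (ht₀ : T ≤ t₀)
    (hT : f T < ε + c / 2 * (t₀ - T) ^ 2) (hft₀ : ε < f t₀) :
    0 ≤ g t₀ ∧ ∀ t, t₀ ≤ t → ε < f t ∧ f t₀ + c / 2 * (t - t₀) ^ 2 ≤ f t := by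
  have hgt₀ : 0 ≤ g t₀ := by
    by_contra! hlt
    have hpos : ∀ t ∈ Icc T t₀, ε < f t :=
      lt_of_weighted_convex_left (ρ := fun _ => 1) (by simpa using fun t ht _ => hf t ht)
        (fun t ht => hg t ht.1) (fun _ _ => zero_le_one)
        (fun t ht hlt => hc.trans (hh t ht.1 hlt)) hft₀ hlt.le
    have := add_sq_le_left ht₀ (fun t ht => hf t ht.1) (fun t ht => hg t ht.1)
      (fun t ht => hh t ht.1 (hpos t ht)) hlt.le
    linarith
  refine ⟨hgt₀, fun t ht => ?_⟩
  have hpos : ∀ x ∈ Icc t₀ t, ε < f x :=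
    lt_of_weighted_convex_right (ρ := fun _ => 1)
      (by simpa using fun x hx _ => hf x (ht₀.trans hx))
      (fun x hx => hg x (ht₀.trans hx.1)) (fun _ _ => zero_le_one)
      (fun x hx hlt => hc.trans (hh x (ht₀.trans hx.1) hlt)) hft₀ hgt₀
  exact ⟨hpos t (right_mem_Icc.2 ht), add_sq_le_right ht (fun x hx => hf x (ht₀.trans hx.1))
    (fun x hx => hg x (ht₀.trans hx.1)) (fun x hx => hh x (ht₀.trans hx.1) (hpos x hx)) hgt₀⟩

/-- A positive function with `f'' ≥ 2 f³`, growing quadratically, cannot exist on a half-line. -/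
lemma blowup_of_two_mul_cube_le {f g h : ℝ → ℝ} {c t₀ : ℝ} (hc : 0 < c)
    (hf : ∀ t, t₀ ≤ t → HasDerivAt f (g t) t) (hg : ∀ t, t₀ ≤ t → HasDerivAt g (h t) t)
    (hpos : ∀ t, t₀ ≤ t → 0 < f t) (hh : ∀ t, t₀ ≤ t → 2 * f t ^ 3 ≤ h t)
    (hg₀ : 0 ≤ g t₀) (hgrow : ∀ t, t₀ ≤ t → f t₀ + c / 2 * (t - t₀) ^ 2 ≤ f t) : False := by
  have hgnn : ∀ t, t₀ ≤ t → 0 ≤ g t := fun t ht =>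
    hg₀.trans (le_of_hasDerivAt_nonneg ht (fun x hx => hg x hx.1)
      (fun x hx => le_trans (by have := hpos x hx.1; positivity) (hh x hx.1)))
  have hw : ∀ t, t₀ ≤ t → 0 ≤ f t - f t₀ := fun t ht => by
    have := hgrow t ht
    have : 0 ≤ c / 2 * (t - t₀) ^ 2 := by positivity
    linarith
  have hsq : ∀ t, t₀ ≤ t → (f t - f t₀) ^ 2 ≤ g t := fun t ht => by
    have := le_of_hasDerivAt_nonneg (f := fun x => g x ^ 2 - (f x - f t₀) ^ 4)
      (g := fun x => 2 * g x * (h x - 2 * (f x - f t₀) ^ 3)) ht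
      (fun x hx => (((hg x hx.1).fun_pow 2).fun_sub
        (((hf x hx.1).sub_const (f t₀)).fun_pow 4)).congr_deriv (by norm_num; ring))
      (fun x hx => by
        have h1 : (f x - f t₀) ^ 3 ≤ f x ^ 3 :=
          pow_le_pow_left₀ (hw x hx.1) (by linarith [hpos t₀ le_rfl]) 3
        have h2 := hh x hx.1
        exact mul_nonneg (by linarith [hgnn x hx.1]) (by linarith))
    simp only [sub_self] at this
    refine abs_le_of_sq_le_sq' ?_ (hgnn t ht) |>.2
    nlinarith [sq_nonneg (g t₀)]
  have hw1 : ∀ t, t₀ + 1 ≤ t → 0 < f t - f t₀ := fun t ht => by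
    have := hgrow t (by linarith)
    have : 0 < t - t₀ := by linarith
    have : 0 < c / 2 * (t - t₀) ^ 2 := by positivity
    linarith
  set b := (f (t₀ + 1) - f t₀)⁻¹
  have hb : 0 < b := inv_pos.2 (hw1 _ le_rfl)
  have hanti := le_of_hasDerivAt_nonneg (f := fun x => -(f x - f t₀)⁻¹ - x)
    (g := fun x => g x / (f x - f t₀) ^ 2 - 1) (a := t₀ + 1) (b := t₀ + 1 + b) (by linarith)
    (fun x hx => (((((hf x (by linarith [hx.1])).sub_const (f t₀)).fun_inv
      (hw1 x hx.1).ne').fun_neg).fun_sub (hasDerivAt_id' x)).congr_deriv (by ring))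
    (fun x hx => by
      have := pow_pos (hw1 x hx.1) 2
      rw [sub_nonneg, one_le_div this]
      exact hsq x (by linarith [hx.1]))
  have := inv_pos.2 (hw1 (t₀ + 1 + b) (by linarith))
  linarith

lemma IsLocalMin.deriv_deriv_nonneg {f : ℝ → ℝ} {x : ℝ} (hx : IsLocalMin f x)
    (hf : ContinuousAt f x) : 0 ≤ deriv (deriv f) x := by
  by_contra! hlt
  have hmax : IsLocalMax f x := isLocalMax_of_deriv_deriv_neg hlt hx.deriv_eq_zero hf
  have heq : f =ᶠ[𝓝 x] fun _ => f x := by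
    filter_upwards [hx, hmax] with t h1 h2 using le_antisymm h2 h1
  have : deriv (deriv f) x = 0 := by
    rw [heq.deriv.deriv_eq]
    simp
  linarith

namespace PainleveSol

variable {α : ℝ} {y : ℝ → ℝ}

lemma hasDerivAt (hy : PainleveSol α y) (s : ℝ) : HasDerivAt y (deriv y s) s :=
  (hy.1.differentiable (by norm_num) s).hasDerivAt

lemma hasDerivAt_deriv (hy : PainleveSol α y) (s : ℝ) :
    HasDerivAt (deriv y) (s * y s + 2 * y s ^ 3 + α) s := by
  rw [← hy.2 s]
  have : ContDiff ℝ 1 (deriv y) := (contDiff_succ_iff_deriv (n := 1).1 hy.1).2.2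
  exact (this.differentiable (by norm_num) s).hasDerivAt

lemma pos (hα : α < 0) (hy : PainleveSol α y) (hnonneg : ∀ s, 0 ≤ y s) (s : ℝ) : 0 < y s := by
  refine (hnonneg s).lt_of_ne' fun h0 => ?_
  have hmin : IsLocalMin y s := Eventually.of_forall fun t => h0 ▸ hnonneg t
  have := hmin.deriv_deriv_nonneg (hy.hasDerivAt s).continuousAt
  rw [hy.2, h0] at this
  linarith

lemma not_deriv_pos_right (hy : PainleveSol α y) (hpos : ∀ s, 0 < y s)
    (hbdd : ∃ m M : ℝ, ∀ s : ℝ, m ≤ s → |y s| ≤ M) (s₀ : ℝ) :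
    ¬ ∀ t, s₀ ≤ t → 0 < deriv y t := by
  intro hd
  obtain ⟨m, M, hM⟩ := hbdd
  have hge : ∀ t, s₀ ≤ t → y s₀ ≤ y t := fun t ht =>
    le_of_hasDerivAt_nonneg ht (fun x _ => hy.hasDerivAt x) (fun x hx => (hd x hx.1).le)
  set S := max (max s₀ m) (max 0 ((2 - α) / y s₀))
  have hS₀ : s₀ ≤ S := (le_max_left _ _).trans (le_max_left _ _)
  have hSm : m ≤ S := (le_max_right _ _).trans (le_max_left _ _)
  have hS0 : 0 ≤ S := (le_max_left _ _).trans (le_max_right _ _)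
  have hSα : (2 - α) / y s₀ ≤ S := (le_max_right _ _).trans (le_max_right _ _)
  rw [div_le_iff₀ (hpos s₀)] at hSα
  have hM0 : 0 ≤ M := (abs_nonneg _).trans (hM S hSm)
  have := add_sq_le_right (c := 2) (a := S) (b := S + (M + 1)) (by linarith)
    (fun x _ => hy.hasDerivAt x) (fun x _ => hy.hasDerivAt_deriv x)
    (fun x hx => by
      have h1 : S * y s₀ ≤ x * y x :=
        mul_le_mul hx.1 (hge x (hS₀.trans hx.1)) (hpos s₀).le (hS0.trans hx.1)
      have h2 := pow_pos (hpos x) 3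
      linarith) (hd S hS₀).le
  have h1 := le_of_abs_le (hM (S + (M + 1)) (by linarith))
  nlinarith [hpos S]

lemma not_deriv_pos_left (hα : α < 0) (hy : PainleveSol α y) (hpos : ∀ s, 0 < y s) (s₀ : ℝ) :
    ¬ ∀ t, t ≤ s₀ → 0 < deriv y t := by
  intro hd
  have hle : ∀ t, t ≤ s₀ → y t ≤ y s₀ := fun t ht =>
    le_of_hasDerivAt_nonneg ht (fun x _ => hy.hasDerivAt x) (fun x hx => (hd x hx.2).le)
  set S := min s₀ (-2 * y s₀ ^ 2)
  obtain ⟨r, hr0, hr⟩ : ∃ r : ℝ, 0 ≤ r ∧ y s₀ < -α / 2 * r ^ 2 := by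
    refine ⟨1 + y s₀ / (-α / 2), ?_, ?_⟩
    · have := div_pos (hpos s₀) (show 0 < -α / 2 by linarith)
      linarith
    · have h1 : 0 < -α / 2 := by linarith
      have h2 := div_pos (hpos s₀) h1
      have h3 : -α / 2 * (y s₀ / (-α / 2)) = y s₀ := mul_div_cancel₀ _ h1.ne'
      nlinarith [mul_pos h1 h2, mul_pos h1 (pow_pos h2 2)]
  have := add_sq_le_left (f := fun t => -y t) (g := fun t => -deriv y t) (c := -α) (a := S - r)
    (b := S) (by linarith) (fun x _ => (hy.hasDerivAt x).fun_neg)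
    (fun x _ => (hy.hasDerivAt_deriv x).fun_neg)
    (fun x hx => by
      have h1 : x ≤ s₀ := hx.2.trans (min_le_left _ _)
      have h2 : x ≤ -2 * y s₀ ^ 2 := hx.2.trans (min_le_right _ _)
      have h3 : y x ^ 2 ≤ y s₀ ^ 2 := pow_le_pow_left₀ (hpos x).le (hle x h1) 2
      nlinarith [mul_nonneg (hpos x).le (show 0 ≤ -x - 2 * y x ^ 2 by linarith)])
    (by simpa using (hd S (min_le_left _ _)).le)
  have h1 := hle S (min_le_left _ _)
  have h2 := hpos (S - r)
  rw [show S - (S - r) = r by ring] at this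
  linarith

lemma deriv_neg (hα : α < 0) (hy : PainleveSol α y) (hpos : ∀ s, 0 < y s)
    (hbdd : ∃ m M : ℝ, ∀ s : ℝ, m ≤ s → |y s| ≤ M) (s : ℝ) : deriv y s < 0 := by
  have hlog : ∀ t, HasDerivAt (fun x => deriv y x / y x)
      ((y t ^ 2)⁻¹ * (y t * (t * y t + 2 * y t ^ 3 + α) - deriv y t ^ 2)) t := fun t =>
    ((hy.hasDerivAt_deriv t).fun_div (hy.hasDerivAt t) (hpos t).ne').congr_deriv (by
      have := (hpos t).ne'
      field_simp)
  have hW : ∀ t, HasDerivAt (fun x => y x * (x * y x + 2 * y x ^ 3 + α) - deriv y x ^ 2)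
      (y t ^ 2 + deriv y t * (4 * y t ^ 3 - α)) t := fun t =>
    (((hy.hasDerivAt t).fun_mul ((((hasDerivAt_id' t).fun_mul (hy.hasDerivAt t)).fun_add
      (((hy.hasDerivAt t).fun_pow 3).const_mul 2)).add_const α)).fun_sub
      ((hy.hasDerivAt_deriv t).fun_pow 2)).congr_deriv (by norm_num; ring)
  have hWnn : ∀ t, 0 < deriv y t / y t → 0 ≤ y t ^ 2 + deriv y t * (4 * y t ^ 3 - α) :=
    fun t ht => by
      have h1 : 0 < deriv y t := (div_pos_iff_of_pos_right (hpos t)).1 ht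
      have h2 : 0 < 4 * y t ^ 3 - α := by linarith [pow_pos (hpos t) 3]
      positivity
  have hle : ∀ t, deriv y t ≤ 0 := by
    intro t
    by_contra! ht
    have hlt : 0 < deriv y t / y t := div_pos ht (hpos t)
    rcases le_total 0 (y t * (t * y t + 2 * y t ^ 3 + α) - deriv y t ^ 2) with h | h
    · refine hy.not_deriv_pos_right hpos hbdd t fun x hx => ?_
      exact (div_pos_iff_of_pos_right (hpos x)).1 <| lt_of_weighted_convex_right
        (fun z _ => hlog z) (fun z _ => hW z) (fun z _ => by positivity)
        (fun z _ => hWnn z) hlt h x (right_mem_Icc.2 hx)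
    · refine hy.not_deriv_pos_left hα hpos t fun x hx => ?_
      exact (div_pos_iff_of_pos_right (hpos x)).1 <| lt_of_weighted_convex_left
        (fun z _ => hlog z) (fun z _ => hW z) (fun z _ => by positivity)
        (fun z _ => hWnn z) hlt h x (left_mem_Icc.2 hx)
  refine (hle s).lt_of_ne fun h0 => ?_
  have hmin : IsLocalMin (fun t => -deriv y t) s :=
    Eventually.of_forall fun t => by simpa [h0] using hle t
  have h1 := hmin.deriv_deriv_nonneg (hy.hasDerivAt_deriv s).continuousAt.fun_neg
  have h2 : deriv (fun t => -deriv y t) = fun t => -(t * y t + 2 * y t ^ 3 + α) :=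
    funext fun t => (hy.hasDerivAt_deriv t).fun_neg.deriv
  have h3 : HasDerivAt (fun t => -(t * y t + 2 * y t ^ 3 + α)) (-y s) s :=
    (((((hasDerivAt_id' s).fun_mul (hy.hasDerivAt s)).fun_add
      (((hy.hasDerivAt s).fun_pow 3).const_mul 2)).add_const α).fun_neg).congr_deriv (by
        rw [h0]; ring)
  rw [h2, h3.deriv] at h1
  linarith [hpos s]

/-- The derivatives of a solution after the reflection `s = -t`. -/
lemma hasDerivAt_comp_neg (hy : PainleveSol α y) (t : ℝ) :
    HasDerivAt (fun x => y (-x)) (-deriv y (-t)) t := (hy.hasDerivAt (-t)).comp_neg_id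

lemma hasDerivAt_neg_deriv_comp_neg (hy : PainleveSol α y) (t : ℝ) :
    HasDerivAt (fun x => -deriv y (-x)) (-t * y (-t) + 2 * y (-t) ^ 3 + α) t := by
  simpa using (hy.hasDerivAt_deriv (-t)).comp_neg_id.fun_neg

end PainleveSol

lemma hasDerivAt_sqrt_half {t : ℝ} (ht : 0 < t) :
    HasDerivAt (fun x => √(x / 2)) (1 / (4 * √(t / 2))) t :=
  (((hasDerivAt_id' t).div_const 2).sqrt (by positivity)).congr_deriv (by
    have : 0 < √(t / 2) := by positivity
    field_simp
    norm_num)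

lemma hasDerivAt_deriv_sqrt_half {t : ℝ} (ht : 0 < t) :
    HasDerivAt (fun x => 1 / (4 * √(x / 2))) (-(1 / (16 * √(t / 2) ^ 3))) t := by
  have hpos : 0 < √(t / 2) := by positivity
  refine ((hasDerivAt_const t (1 : ℝ)).fun_div ((hasDerivAt_sqrt_half ht).const_mul 4)
    (by positivity)).congr_deriv ?_
  field_simp
  norm_num

namespace PainleveSol

variable {α : ℝ} {y : ℝ → ℝ}

lemma eventually_sqrt_half_le (hα : α < 0) (hy : PainleveSol α y) (hpos : ∀ s, 0 < y s) :
    ∀ᶠ t in atTop, √(t / 2) ≤ y (-t) := by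
  set T := 2 * (1 - 1 / α) ^ 2
  have hα' : 0 < -1 / α := div_pos_of_neg_of_neg (by norm_num) hα
  have hα1 : (1 : ℝ) < 1 - 1 / α := by
    have : -1 / α = -(1 / α) := by ring
    linarith
  have hT : 0 < T := by positivity
  have hφ : ∀ t, T ≤ t → 1 - 1 / α ≤ √(t / 2) := fun t ht => by
    apply Real.le_sqrt_of_sq_le
    simp only [T] at ht
    linarith
  have hφ'' : ∀ t, T ≤ t → 1 / (16 * √(t / 2) ^ 3) ≤ -α / 2 := fun t ht => by
    have h1 := hφ t ht
    have h2 : 1 ≤ √(t / 2) := by linarith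
    have h3 : √(t / 2) ≤ √(t / 2) ^ 3 := le_self_pow₀ h2 (by norm_num)
    have h4 : 1 ≤ -α * √(t / 2) := by
      have : -α * (1 - 1 / α) = -α + 1 := by field_simp [hα.ne]; ring
      nlinarith
    rw [div_le_iff₀ (by positivity)]
    nlinarith
  have hc : 0 < -α / 2 := by linarith
  have hfar : ∀ᶠ t in atTop, √(T / 2) - y (-T) < 0 + -α / 2 / 2 * (t - T) ^ 2 := by
    have : Tendsto (fun t : ℝ => -α / 2 / 2 * (t - T) ^ 2) atTop atTop :=
      ((tendsto_pow_atTop two_ne_zero).comp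
        (tendsto_atTop_add_const_right atTop (-T) tendsto_id)).const_mul_atTop (by positivity)
    simpa using this.eventually_gt_atTop _
  filter_upwards [hfar, eventually_ge_atTop T] with t₀ hfar ht₀
  by_contra! hlt
  have key := (quadratic_growth_of_lt (f := fun t => √(t / 2) - y (-t)) (ε := 0) hc.le
    (fun t ht => (hasDerivAt_sqrt_half (hT.trans_le ht)).fun_sub (hy.hasDerivAt_comp_neg t))
    (fun t ht => (hasDerivAt_deriv_sqrt_half (hT.trans_le ht)).fun_sub
      (hy.hasDerivAt_neg_deriv_comp_neg t))
    (fun t ht hd => by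
      have h1 := hφ'' t ht
      have h2 : √(t / 2) ^ 2 = t / 2 := Real.sq_sqrt (by linarith)
      have h3 := hpos (-t)
      have h4 : y (-t) ^ 2 ≤ √(t / 2) ^ 2 := pow_le_pow_left₀ h3.le (by linarith) 2
      nlinarith [mul_nonneg h3.le (show 0 ≤ t - 2 * y (-t) ^ 2 by linarith)])
    ht₀ hfar (by linarith)).2
  have ht₀pos : 0 < t₀ := hT.trans_le ht₀
  set x := 1 + (t₀ + 2) / (-α / 2 / 2)
  have hx : 1 < x := by
    have : 0 < (t₀ + 2) / (-α / 2 / 2) := by positivity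
    exact lt_add_of_pos_right 1 this
  have hcx : t₀ + 2 ≤ -α / 2 / 2 * x := by
    have : -α / 2 / 2 * ((t₀ + 2) / (-α / 2 / 2)) = t₀ + 2 := mul_div_cancel₀ _ (by positivity)
    simp only [x]
    linarith
  have h1 := (key (t₀ + x) (by linarith)).2
  have h2 : √((t₀ + x) / 2) ≤ t₀ + x := by
    rw [Real.sqrt_le_left (by linarith)]
    nlinarith
  have h3 := hpos (-(t₀ + x))
  rw [show t₀ + x - t₀ = x by ring] at h1
  nlinarith

lemma eventually_le_sqrt_half_add (hα : α < 0) (hy : PainleveSol α y) (hpos : ∀ s, 0 < y s)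
    {ε : ℝ} (hε : 0 < ε) : ∀ᶠ t in atTop, y (-t) ≤ √(t / 2) + ε := by
  obtain ⟨T₁, hT₁⟩ := eventually_atTop.1 (hy.eventually_sqrt_half_le hα hpos)
  set T := max (max T₁ 1) (-α / ε)
  have hTT₁ : T₁ ≤ T := (le_max_left _ _).trans (le_max_left _ _)
  have hT : 0 < T := zero_lt_one.trans_le ((le_max_right _ _).trans (le_max_left _ _))
  have hTε : ∀ t, T ≤ t → -α ≤ t * ε := fun t ht =>
    (div_le_iff₀ hε).1 ((le_max_right _ _).trans ht)
  have hlow : ∀ t, T ≤ t → ε < y (-t) - √(t / 2) →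
      max (-α) (2 * (y (-t) - √(t / 2)) ^ 3) ≤
        -t * y (-t) + 2 * y (-t) ^ 3 + α - -(1 / (16 * √(t / 2) ^ 3)) := fun t ht he => by
    have ht0 := hT.trans_le ht
    have hφ : 0 < √(t / 2) := by positivity
    have h1 : 0 < 1 / (16 * √(t / 2) ^ 3) := by positivity
    have h2 := hTε t ht
    set e := y (-t) - √(t / 2)
    have h3 : y (-t) = e + √(t / 2) := by ring
    have h4 : √(t / 2) ^ 2 = t / 2 := Real.sq_sqrt (by linarith)
    have he0 : 0 < e := hε.trans he
    have h5 : -t * y (-t) + 2 * y (-t) ^ 3 = 2 * e ^ 3 + 6 * e ^ 2 * √(t / 2) + 2 * t * e := by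
      have h6 : t = 2 * √(t / 2) ^ 2 := by linarith
      rw [h3]
      generalize √(t / 2) = φ at *
      rw [h6]
      ring
    have h7 : 0 < 6 * e ^ 2 * √(t / 2) := by positivity
    have h8 : 0 < e ^ 3 := by positivity
    have h9 : t * ε ≤ t * e := mul_le_mul_of_nonneg_left he.le ht0.le
    rw [h5]
    exact max_le (by linarith) (by linarith)
  have hfar : ∀ᶠ t in atTop, y (-T) - √(T / 2) < ε + -α / 2 * (t - T) ^ 2 := by
    have : Tendsto (fun t : ℝ => -α / 2 * (t - T) ^ 2) atTop atTop :=
      ((tendsto_pow_atTop two_ne_zero).comp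
        (tendsto_atTop_add_const_right atTop (-T) tendsto_id)).const_mul_atTop (by linarith)
    simpa using (tendsto_atTop_add_const_left atTop ε this).eventually_gt_atTop _
  filter_upwards [hfar, eventually_ge_atTop T] with t₀ hfar ht₀
  by_contra! hlt
  have hd1 : ∀ t, T ≤ t → HasDerivAt (fun x => y (-x) - √(x / 2))
      (-deriv y (-t) - 1 / (4 * √(t / 2))) t := fun t ht =>
    (hy.hasDerivAt_comp_neg t).fun_sub (hasDerivAt_sqrt_half (hT.trans_le ht))
  have hd2 : ∀ t, T ≤ t → HasDerivAt (fun x => -deriv y (-x) - 1 / (4 * √(x / 2)))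
      (-t * y (-t) + 2 * y (-t) ^ 3 + α - -(1 / (16 * √(t / 2) ^ 3))) t := fun t ht =>
    (hy.hasDerivAt_neg_deriv_comp_neg t).fun_sub (hasDerivAt_deriv_sqrt_half (hT.trans_le ht))
  obtain ⟨hg₀, hgrow⟩ := quadratic_growth_of_lt (ε := ε) (c := -α) (by linarith) hd1 hd2
    (fun t ht he => (le_max_left _ _).trans (hlow t ht he)) ht₀ hfar (by linarith)
  exact blowup_of_two_mul_cube_le (c := -α) (by linarith)
    (fun t ht => hd1 t (ht₀.trans ht)) (fun t ht => hd2 t (ht₀.trans ht))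
    (fun t ht => hε.trans (hgrow t ht).1)
    (fun t ht => (le_max_right _ _).trans (hlow t (ht₀.trans ht) (hgrow t ht).1))
    hg₀ (fun t ht => (hgrow t ht).2)

lemma tendsto_sub_sqrt_atBot (hα : α < 0) (hy : PainleveSol α y) (hpos : ∀ s, 0 < y s) :
    Tendsto (fun s => y s - √(|s| / 2)) atBot (𝓝 0) := by
  rw [Metric.tendsto_nhds]
  intro ε hε
  filter_upwards [tendsto_neg_atBot_atTop.eventually (hy.eventually_sqrt_half_le hα hpos),
    tendsto_neg_atBot_atTop.eventually (hy.eventually_le_sqrt_half_add hα hpos (half_pos hε)),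
    eventually_le_atBot 0] with s h1 h2 hs
  rw [neg_neg] at h1 h2
  rw [Real.dist_eq, sub_zero, abs_of_nonpos hs, abs_lt]
  constructor <;> linarith

end PainleveSol

/-- A nonnegative solution of Painlevé II (`α < 0`) bounded near `+∞` is positive, strictly
decreasing, and asymptotic to `√(|s|/2)` at `-∞`. -/
theorem stmt19 (α : ℝ) (hα : α < 0) (y : ℝ → ℝ) (hy : PainleveSol α y)
    (hbdd : ∃ m M : ℝ, ∀ s : ℝ, m ≤ s → |y s| ≤ M)
    (hnonneg : ∀ s : ℝ, 0 ≤ y s) :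
    (∀ s : ℝ, 0 < y s) ∧ (∀ s : ℝ, deriv y s < 0) ∧
    Filter.Tendsto (fun s => y s - Real.sqrt (|s| / 2)) Filter.atBot (𝓝 0) := by
  have hpos := hy.pos hα hnonneg
  exact ⟨hpos, hy.deriv_neg hα hpos hbdd, hy.tendsto_sub_sqrt_atBot hα hpos⟩
end
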